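/- arXiv:2601.15903 — 2 statements merged into one kernel-verified Lean document; each statement's English description precedes it below -/
import Mathlib

section
/- Let 𝔠 = {C_1,…,C_M} (M ≥ 2) be pairwise-distinct binary linear codes of length n such that no code of the family is contained in another (C_j ⊄ C_l for all j ≠ l), and let δ be the minimum cross-code distance of the family. Let i ∈ [M], let T ∈ F_2^{N×n} have all rows in C_i, let E ∈ F_2^{N×n}, and set Y = T + E. Suppose: (1) rank(T) = dim(C_i); and (2) every row of E has Hamming weight at most ⌊(δ−1)/2⌋. Then Δ_SD(Y, C_i) = 0 and Δ_SD(Y, C_j) ≥ 1 for every j ≠ i; in particular, the minimum denoised subspace discrepancy decoder returns the true code C_i. -/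
open Submodule Module

/-- The subspace distance between two subspaces. -/
noncomputable def sdist {F V : Type*} [Field F] [AddCommGroup V] [Module F V]
    (U W : Submodule F V) : ℕ :=
  finrank F ↥(U ⊔ W) - finrank F ↥(U ⊓ W)

/-- The row space of a matrix. -/
def rowSpace {F : Type*} [Field F] {m n : Type*} (A : Matrix m n F) :
    Submodule F (n → F) :=
  Submodule.span F (Set.range fun r => A r)

/-- The minimum cross-code distance `δ` of a family of codes: the minimum Hamming distance
between any pair of distinct codewords taken from any two distinct codes of the family. -/
noncomputable def crossDist {M n : ℕ}
    (C : Fin M → Submodule (ZMod 2) (Fin n → ZMod 2)) : ℕ :=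
  sInf {d | ∃ i j, i ≠ j ∧ ∃ c ∈ C i, ∃ c' ∈ C j, c ≠ c' ∧ d = hammingDist c c'}

open Classical in
/-- The denoised vector of `y` with respect to a code `Cj` (relative to a distance
parameter `δ`): a codeword `c ∈ Cj` with `d_H(c,y) < δ/2` if one exists, else `y` itself. -/
noncomputable def denoise {n : ℕ} (δ : ℕ) (Cj : Submodule (ZMod 2) (Fin n → ZMod 2))
    (y : Fin n → ZMod 2) : Fin n → ZMod 2 :=
  if h : ∃ c ∈ Cj, 2 * hammingDist c y < δ then h.choose else y

/-- The denoised matrix `D_j(Y)`: the matrix obtained from `Y` by denoising each row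
with respect to the code `Cj`. -/
noncomputable def denoiseMatrix {N n : ℕ} (δ : ℕ)
    (Cj : Submodule (ZMod 2) (Fin n → ZMod 2)) (Y : Matrix (Fin N) (Fin n) (ZMod 2)) :
    Matrix (Fin N) (Fin n) (ZMod 2) :=
  Matrix.of fun r => denoise δ Cj (Y r)

/-- The denoised subspace discrepancy `Δ_SD(Y, Cj) = d_s(⟨D_j(Y)⟩, Cj)`. -/
noncomputable def discSD {N n : ℕ} (δ : ℕ)
    (Cj : Submodule (ZMod 2) (Fin n → ZMod 2)) (Y : Matrix (Fin N) (Fin n) (ZMod 2)) : ℕ :=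
  sdist (rowSpace (denoiseMatrix δ Cj Y)) Cj

theorem sdist_eq_zero_iff {F V : Type*} [Field F] [AddCommGroup V] [Module F V]
    [FiniteDimensional F V] {U W : Submodule F V} : sdist U W = 0 ↔ U = W := by
  refine ⟨fun h => ?_, fun h => by subst h; rw [sdist, sup_idem, inf_idem, Nat.sub_self]⟩
  have h' : U ⊓ W = U ⊔ W :=
    Submodule.eq_of_le_of_finrank_le inf_le_sup (Nat.sub_eq_zero_iff_le.mp h)
  exact inf_eq_sup.mp h'

theorem rowSpace_le_iff {F : Type*} [Field F] {m n : Type*} {A : Matrix m n F}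
    {W : Submodule F (n → F)} : rowSpace A ≤ W ↔ ∀ r, A r ∈ W := by
  simp [rowSpace, Submodule.span_le, Set.range_subset_iff]

theorem rowSpace_eq_of_rank_eq {F : Type*} [Field F] {m n : Type*} [Finite m] [Fintype n]
    {A : Matrix m n F} {W : Submodule F (n → F)} (hA : ∀ r, A r ∈ W)
    (hrank : A.rank = finrank F W) : rowSpace A = W := by
  refine Submodule.eq_of_le_of_finrank_eq (rowSpace_le_iff.mpr hA) ?_
  rw [← hrank, Matrix.rank_eq_finrank_span_row]
  rfl

theorem crossDist_le_hammingDist {M n : ℕ} {C : Fin M → Submodule (ZMod 2) (Fin n → ZMod 2)}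
    {i j : Fin M} (hij : i ≠ j) {c c' : Fin n → ZMod 2} (hc : c ∈ C i) (hc' : c' ∈ C j)
    (hne : c ≠ c') : crossDist C ≤ hammingDist c c' :=
  Nat.sInf_le ⟨i, j, hij, c, hc, c', hc', hne, rfl⟩

/-- Since every code contains `0`, the cross-code distance also bounds the distance between
distinct codewords of a single code. -/
theorem crossDist_le_hammingDist_of_mem {M n : ℕ} (hM : 2 ≤ M)
    {C : Fin M → Submodule (ZMod 2) (Fin n → ZMod 2)} {i j : Fin M}
    {c c' : Fin n → ZMod 2} (hc : c ∈ C i) (hc' : c' ∈ C j) (hne : c ≠ c') :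
    crossDist C ≤ hammingDist c c' := by
  by_cases hij : i = j
  · subst hij
    have : Nontrivial (Fin M) := Fin.nontrivial_iff_two_le.mpr hM
    obtain ⟨k, hk⟩ := exists_ne i
    have h := crossDist_le_hammingDist hk.symm ((C i).add_mem ((C i).neg_mem hc) hc') (C k).zero_mem
      (neg_add_eq_zero.not.mpr hne)
    rwa [hammingDist_zero_right, ← hammingDist_eq_hammingNorm] at h
  · exact crossDist_le_hammingDist hij hc hc' hne

theorem crossDist_pos {M n : ℕ} {C : Fin M → Submodule (ZMod 2) (Fin n → ZMod 2)}
    {i j : Fin M} (hij : i ≠ j) (hle : ¬ C i ≤ C j) : 0 < crossDist C := by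
  obtain ⟨c, hc, hcj⟩ := SetLike.not_le_iff_exists.mp hle
  have hne : c ≠ 0 := fun h => hcj (h ▸ (C j).zero_mem)
  obtain ⟨k, l, -, a, -, b, -, hab, h⟩ := Nat.sInf_mem
    (s := {d | ∃ i j, i ≠ j ∧ ∃ c ∈ C i, ∃ c' ∈ C j, c ≠ c' ∧ d = hammingDist c c'})
    ⟨_, i, j, hij, c, hc, 0, (C j).zero_mem, hne, rfl⟩
  rw [crossDist, h]
  exact hammingDist_pos.mpr hab

theorem denoise_spec {n δ : ℕ} {W : Submodule (ZMod 2) (Fin n → ZMod 2)} {y : Fin n → ZMod 2}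
    (h : ∃ c ∈ W, 2 * hammingDist c y < δ) :
    denoise δ W y ∈ W ∧ 2 * hammingDist (denoise δ W y) y < δ := by
  rw [denoise, dif_pos h]
  exact h.choose_spec

theorem exists_near_of_denoise_mem {n δ : ℕ} (hδ : 0 < δ)
    {W : Submodule (ZMod 2) (Fin n → ZMod 2)} {y : Fin n → ZMod 2} (hy : denoise δ W y ∈ W) :
    ∃ c ∈ W, 2 * hammingDist c y < δ := by
  by_contra h
  rw [denoise, dif_neg h] at hy
  exact h ⟨y, hy, by simpa using hδ⟩

/-- If `y` is within half the cross-code distance of a codeword `t`, then denoising `y` with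
respect to any code of the family that has some codeword that close recovers `t`. -/
theorem denoise_eq_of_near {M n : ℕ} (hM : 2 ≤ M)
    {C : Fin M → Submodule (ZMod 2) (Fin n → ZMod 2)} {i j : Fin M} {t y : Fin n → ZMod 2}
    (ht : t ∈ C i) (hty : 2 * hammingDist t y < crossDist C)
    (h : ∃ c ∈ C j, 2 * hammingDist c y < crossDist C) :
    denoise (crossDist C) (C j) y = t := by
  obtain ⟨hmem, hdist⟩ := denoise_spec h
  by_contra hne
  have hle := crossDist_le_hammingDist_of_mem hM hmem ht hne
  have htri := hammingDist_triangle_right (denoise (crossDist C) (C j) y) t y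
  omega

/-- **Guaranteed identification by the M-DenSD decoder (Theorem 2).**
Let `𝔠 = {C_1,…,C_M}` (`M ≥ 2`) be pairwise-distinct binary linear codes of length `n`
such that no code is contained in another, with minimum cross-code distance `δ`. Let `C_i`
be the true code, `T` a matrix all of whose rows lie in `C_i`, and `Y = T + E`. If
(1) `rank T = dim C_i` and (2) every row of `E` has Hamming weight at most `⌊(δ−1)/2⌋`,
then `Δ_SD(Y, C_i) = 0` and `Δ_SD(Y, C_j) ≥ 1` for every `j ≠ i`; in particular the
minimum denoised subspace discrepancy decoder returns the true code `C_i`. -/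
theorem mDenSD_decoder_correct_full_rank {M n N : ℕ} (hM : 2 ≤ M)
    (C : Fin M → Submodule (ZMod 2) (Fin n → ZMod 2)) (hC : Function.Injective C)
    (hnotle : ∀ j l, j ≠ l → ¬ C j ≤ C l)
    (i : Fin M) (T E Y : Matrix (Fin N) (Fin n) (ZMod 2))
    (hT : ∀ r, T r ∈ C i)
    (hY : Y = T + E)
    (hrank : T.rank = finrank (ZMod 2) ↥(C i))
    (hE : ∀ r, hammingNorm (E r) ≤ (crossDist C - 1) / 2) :
    discSD (crossDist C) (C i) Y = 0 ∧
    ∀ j, j ≠ i → 1 ≤ discSD (crossDist C) (C j) Y := by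
  have : Nontrivial (Fin M) := Fin.nontrivial_iff_two_le.mpr hM
  obtain ⟨k, hk⟩ := exists_ne i
  have hδ : 0 < crossDist C := crossDist_pos hk (hnotle k i hk)
  have hnear (r : Fin N) : 2 * hammingDist (T r) (Y r) < crossDist C := by
    have hdist : hammingDist (T r) (Y r) = hammingNorm (E r) := by
      rw [hammingDist_eq_hammingNorm, hY]
      exact congrArg hammingNorm (neg_add_cancel_left (T r) (E r))
    have := hE r
    omega
  have hspan : rowSpace T = C i := rowSpace_eq_of_rank_eq hT hrank
  constructor
  · have hden : denoiseMatrix (crossDist C) (C i) Y = T :=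
      funext fun r => denoise_eq_of_near hM (hT r) (hnear r) ⟨T r, hT r, hnear r⟩
    rw [discSD, hden, sdist_eq_zero_iff, hspan]
  · intro j hj
    rw [Nat.one_le_iff_ne_zero, discSD, Ne, sdist_eq_zero_iff]
    intro h
    refine hnotle i j hj.symm (hspan ▸ rowSpace_le_iff.mpr fun r => ?_)
    have hmem : denoise (crossDist C) (C j) (Y r) ∈ C j := rowSpace_le_iff.mp h.le r
    rwa [denoise_eq_of_near hM (hT r) (hnear r) (exists_near_of_denoise_mem hδ hmem)] at hmem
end

section
/- The subspace distance d_s is a metric on the set of all subspaces of a finite-dimensional vector space V over a field: for all subspaces U, V, W, (i) d_s(U,V) = 0 if and only if U = V; (ii) d_s(U,V) = d_s(V,U); and (iii) d_s(U,W) ≤ d_s(U,V) + d_s(V,W). -/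
open Submodule Module

/-- Two intersections with `W` together exceed `dim W` by at most `dim (U ⊓ X)`. -/
theorem finrank_inf_add_finrank_inf_le {F V : Type*} [Field F] [AddCommGroup V] [Module F V]
    [FiniteDimensional F V] (U W X : Submodule F V) :
    finrank F ↥(U ⊓ W) + finrank F ↥(W ⊓ X) ≤ finrank F W + finrank F ↥(U ⊓ X) := by
  rw [← finrank_sup_add_finrank_inf_eq]
  exact add_le_add (finrank_mono (sup_le inf_le_right inf_le_left))
    (finrank_mono (inf_le_inf inf_le_left inf_le_right))

/-- The subspace distance is a metric on the set of all subspaces of a finite-dimensional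
vector space over a field: it vanishes exactly on equal pairs, is symmetric, and satisfies
the triangle inequality. -/
theorem sdist_is_metric
    {F V : Type*} [Field F] [AddCommGroup V] [Module F V] [FiniteDimensional F V] :
    (∀ U W : Submodule F V, sdist U W = 0 ↔ U = W) ∧
    (∀ U W : Submodule F V, sdist U W = sdist W U) ∧
    (∀ U W X : Submodule F V, sdist U X ≤ sdist U W + sdist W X) := by
  refine ⟨fun U W => ⟨fun h => ?_, ?_⟩, fun U W => ?_, fun U W X => ?_⟩
  · have h_eq : U ⊓ W = U ⊔ W :=
      eq_of_le_of_finrank_le inf_le_sup (Nat.sub_eq_zero_iff_le.mp h)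
    exact inf_eq_sup.mp h_eq
  · rintro rfl
    rw [sdist, sup_idem, inf_idem, Nat.sub_self]
  · rw [sdist, sdist, sup_comm, inf_comm]
  · have hUW := finrank_sup_add_finrank_inf_eq U W
    have hWX := finrank_sup_add_finrank_inf_eq W X
    have hUX := finrank_sup_add_finrank_inf_eq U X
    have h_inf := finrank_inf_add_finrank_inf_le U W X
    unfold sdist
    omega
end
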